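/- Let A, B ⊊ I be proper subsets. The following two-row moves hold in S̃_{k+1}: (a) (Commutation) if i ∈ B, i − 1 ∉ B, and none of i − 1, i, i + 1 lies in A, then d_B d_A = d_{B∖{i}} d_{A∪{i}}; (b) (Chute move) if A = [i, j] and B = [i−1, p] are cyclic intervals with p ∉ A and j ∈ B, then d_B d_A = d_{B∖{j}} d_{A∪{i−1}}; (c) (Zero) if A = [i, j] and B = [p, q] are cyclic intervals with p ∈ A and j ∈ B, then ℓ(d_B d_A) < |A| + |B| (the product is not reduced). -/

import Mathlib

/-- `x : Equiv.Perm ℤ` is an affine permutation in `S̃_{k+1}`: it commutes with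
translation by `k+1` and its window sums to `(k+1)(k+2)/2`. -/
def IsAffinePerm (k : ℕ) (x : Equiv.Perm ℤ) : Prop :=
  (∀ i : ℤ, x (i + (k + 1)) = x i + (k + 1)) ∧
  ∑ i ∈ Finset.Icc (1 : ℤ) (k + 1), x i = (k + 1) * (k + 2) / 2

/-- The underlying function of the simple generator `s_i`. -/
def sAffFun (k : ℕ) (i : ZMod (k + 1)) (j : ℤ) : ℤ :=
  if (j : ZMod (k + 1)) = i then j + 1
  else if (j : ZMod (k + 1)) = i + 1 then j - 1
  else j

theorem sAffFun_invol (k : ℕ) (i : ZMod (k + 1)) (h : ¬ (1 : ZMod (k + 1)) = 0) :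
    Function.Involutive (sAffFun k i) := by
  have hne : i + 1 ≠ i := fun hc => h (by
    have h2 : i + 1 = i + 0 := by simpa using hc
    exact add_left_cancel h2)
  intro j
  by_cases h1 : (j : ZMod (k + 1)) = i
  · have e1 : sAffFun k i j = j + 1 := if_pos h1
    have hj1 : ((j + 1 : ℤ) : ZMod (k + 1)) = i + 1 := by push_cast; rw [h1]
    have e2 : sAffFun k i (j + 1) = j := by
      unfold sAffFun
      rw [if_neg (by rw [hj1]; exact hne), if_pos hj1]
      ring
    rw [e1, e2]
  · by_cases h2 : (j : ZMod (k + 1)) = i + 1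
    · have e1 : sAffFun k i j = j - 1 := by unfold sAffFun; rw [if_neg h1, if_pos h2]
      have hj1 : ((j - 1 : ℤ) : ZMod (k + 1)) = i := by push_cast; rw [h2]; ring
      have e2 : sAffFun k i (j - 1) = j := by
        unfold sAffFun; rw [if_pos hj1]; ring
      rw [e1, e2]
    · have e1 : sAffFun k i j = j := by unfold sAffFun; rw [if_neg h1, if_neg h2]
      rw [e1, e1]

/-- The simple generator `s_i` of the affine symmetric group, as a permutation of `ℤ`:
it interchanges `m(k+1) + ī` and `m(k+1) + ī + 1` for every `m` (when `k ≥ 1`). -/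
noncomputable def sAff (k : ℕ) (i : ZMod (k + 1)) : Equiv.Perm ℤ :=
  if h : (1 : ZMod (k + 1)) = 0 then 1 else Function.Involutive.toPerm _ (sAffFun_invol k i h)

/-- The Coxeter length of `x`: the least number of simple generators whose product is `x`. -/
noncomputable def affLen (k : ℕ) (x : Equiv.Perm ℤ) : ℕ :=
  sInf {n : ℕ | ∃ w : List (ZMod (k + 1)), w.length = n ∧ x = (w.map (sAff k)).prod}

/-- The right descent set `D_R(x) = {i : ℓ(x s_i) < ℓ(x)}`. -/
noncomputable def rightDescents (k : ℕ) (x : Equiv.Perm ℤ) : Set (ZMod (k + 1)) :=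
  {i | affLen k (x * sAff k i) < affLen k x}

/-- The cyclic interval `[i,j] = {i, i+1, …, j}` of residues mod `k+1`. -/
def cycInt (k : ℕ) (i j : ZMod (k + 1)) : Finset (ZMod (k + 1)) :=
  (Finset.range ((j - i).val + 1)).image fun t : ℕ => i + (t : ZMod (k + 1))

/-- A choice of a "gate" residue not belonging to `A` (when `A` is proper). -/
noncomputable def gate (k : ℕ) (A : Finset (ZMod (k + 1))) : ZMod (k + 1) :=
  if h : ∃ g, g ∉ A then h.choose else 0

/-- The cyclically decreasing element `d_A`: the product of the `s_a`, `a ∈ A`, in an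
order where `s_{a+1}` occurs to the left of `s_a` whenever `a, a+1 ∈ A`. -/
noncomputable def dElt (k : ℕ) (A : Finset (ZMod (k + 1))) : Equiv.Perm ℤ :=
  (((((List.range (k + 1)).reverse.map fun t : ℕ => gate k A + (t : ZMod (k + 1))).filter
      fun a => decide (a ∈ A)).map (sAff k)).prod)

/-- The cyclically increasing element `u_A`: the product of the `s_a`, `a ∈ A`, in an
order where `s_{a+1}` occurs to the right of `s_a` whenever `a, a+1 ∈ A`. -/
noncomputable def uElt (k : ℕ) (A : Finset (ZMod (k + 1))) : Equiv.Perm ℤ :=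
  ((((List.range (k + 1)).map fun t : ℕ => gate k A + (t : ZMod (k + 1))).filter
      fun a => decide (a ∈ A)).map (sAff k)).prod

/-- The right decreasing code: `CRD(x)_i = #{j < ī : x(j) > x(ī)}`. -/
noncomputable def CRD (k : ℕ) (x : Equiv.Perm ℤ) (i : ZMod (k + 1)) : ℕ :=
  Set.ncard {j : ℤ | j < (i.val : ℤ) ∧ x (i.val : ℤ) < x j}

/-- The right increasing code: `CRI(x)_i = #{j > ī + 1 : x(j) < x(ī + 1)}`. -/
noncomputable def CRI (k : ℕ) (x : Equiv.Perm ℤ) (i : ZMod (k + 1)) : ℕ :=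
  Set.ncard {j : ℤ | (i.val : ℤ) + 1 < j ∧ x j < x ((i.val : ℤ) + 1)}

/-- The left decreasing code: `CLD(x)_i = #{j < x⁻¹(ī + 1) : x(j) > ī + 1}`. -/
noncomputable def CLD (k : ℕ) (x : Equiv.Perm ℤ) (i : ZMod (k + 1)) : ℕ :=
  Set.ncard {j : ℤ | j < x.symm ((i.val : ℤ) + 1) ∧ (i.val : ℤ) + 1 < x j}

/-- The left increasing code: `CLI(x)_i = #{j > x⁻¹(ī) : x(j) < ī}`. -/
noncomputable def CLI (k : ℕ) (x : Equiv.Perm ℤ) (i : ZMod (k + 1)) : ℕ :=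
  Set.ncard {j : ℤ | x.symm ((i.val : ℤ)) < j ∧ x j < (i.val : ℤ)}

section SimpleGenerators

variable {k : ℕ}

theorem zmod_one_ne_zero (hk : 1 ≤ k) : (1 : ZMod (k + 1)) ≠ 0 := by
  have : Fact (1 < k + 1) := ⟨by omega⟩
  exact one_ne_zero

theorem add_natCast_inj (a : ZMod (k + 1)) {s t : ℕ} (hs : s ≤ k) (ht : t ≤ k) :
    a + (s : ZMod (k + 1)) = a + (t : ZMod (k + 1)) ↔ s = t := by
  rw [add_right_inj, ZMod.natCast_eq_natCast_iff', Nat.mod_eq_of_lt (by omega),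
    Nat.mod_eq_of_lt (by omega)]

theorem add_val_sub (a b : ZMod (k + 1)) : a + (((b - a).val : ℕ) : ZMod (k + 1)) = b := by
  rw [ZMod.natCast_val, ZMod.cast_id]
  ring

theorem sAff_apply (hk : 1 ≤ k) (i : ZMod (k + 1)) (j : ℤ) : sAff k i j = sAffFun k i j := by
  rw [sAff, dif_neg (zmod_one_ne_zero hk)]
  rfl

theorem sAff_apply_of_eq (hk : 1 ≤ k) {i : ZMod (k + 1)} {j : ℤ} (h : (j : ZMod (k + 1)) = i) :
    sAff k i j = j + 1 := by
  rw [sAff_apply hk, sAffFun, if_pos h]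

theorem sAff_apply_of_eq_add_one (hk : 1 ≤ k) {i : ZMod (k + 1)} {j : ℤ}
    (h : (j : ZMod (k + 1)) = i + 1) : sAff k i j = j - 1 := by
  have := zmod_one_ne_zero hk
  rw [sAff_apply hk, sAffFun, if_neg (by rw [h]; simpa using this), if_pos h]

theorem sAff_apply_of_ne (hk : 1 ≤ k) {i : ZMod (k + 1)} {j : ℤ} (h : (j : ZMod (k + 1)) ≠ i)
    (h' : (j : ZMod (k + 1)) ≠ i + 1) : sAff k i j = j := by
  rw [sAff_apply hk, sAffFun, if_neg h, if_neg h']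

theorem sAff_mul_self (hk : 1 ≤ k) (i : ZMod (k + 1)) : sAff k i * sAff k i = 1 := by
  ext j
  simp [sAff_apply hk, sAffFun_invol k i (zmod_one_ne_zero hk) j]

theorem sAff_apply_comm (hk : 1 ≤ k) {a b : ZMod (k + 1)} {j : ℤ} (hab : a ≠ b)
    (h₁ : a ≠ b + 1) (h₂ : b ≠ a + 1)
    (hj : (j : ZMod (k + 1)) = a ∨ (j : ZMod (k + 1)) = a + 1) :
    sAff k a (sAff k b j) = sAff k b (sAff k a j) := by
  rcases hj with h | h
  · rw [sAff_apply_of_ne hk (i := b) (h ▸ hab) (h ▸ h₁), sAff_apply_of_eq hk h,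
      sAff_apply_of_ne hk] <;> push_cast <;> rw [h]
    · exact h₂.symm
    · exact fun h' => hab (add_right_cancel h')
  · rw [sAff_apply_of_ne hk (i := b) (h ▸ h₂.symm)
      (h ▸ fun h' => hab (add_right_cancel h')), sAff_apply_of_eq_add_one hk h,
      sAff_apply_of_ne hk] <;> push_cast <;> rw [h, add_sub_cancel_right]
    · exact hab
    · exact h₁

theorem sAff_commute (hk : 1 ≤ k) {a b : ZMod (k + 1)} (h₁ : a ≠ b + 1) (h₂ : b ≠ a + 1) :
    Commute (sAff k a) (sAff k b) := by
  rcases eq_or_ne a b with rfl | hab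
  · exact Commute.refl _
  refine Equiv.ext fun j => ?_
  simp only [Equiv.Perm.mul_apply]
  by_cases ha : (j : ZMod (k + 1)) = a ∨ (j : ZMod (k + 1)) = a + 1
  · exact sAff_apply_comm hk hab h₁ h₂ ha
  by_cases hb : (j : ZMod (k + 1)) = b ∨ (j : ZMod (k + 1)) = b + 1
  · exact (sAff_apply_comm hk hab.symm h₂ h₁ hb).symm
  rw [not_or] at ha hb
  rw [sAff_apply_of_ne hk hb.1 hb.2, sAff_apply_of_ne hk ha.1 ha.2,
    sAff_apply_of_ne hk hb.1 hb.2]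

theorem sAff_braid (hk : 2 ≤ k) (a : ZMod (k + 1)) :
    sAff k (a + 1) * sAff k a * sAff k (a + 1) = sAff k a * sAff k (a + 1) * sAff k a := by
  have h0 := zmod_one_ne_zero (k := k) (by omega)
  have h2 : (1 + 1 : ZMod (k + 1)) ≠ 0 := by
    have := (add_natCast_inj (0 : ZMod (k + 1)) (s := 2) (t := 0) hk (by omega)).not.2 (by omega)
    intro h
    apply this
    push_cast
    linear_combination h
  have hk' : 1 ≤ k := by omega
  have e1 : a ≠ a + 1 := fun h => h0 (by linear_combination -h)
  have e2 : a ≠ a + 1 + 1 := fun h => h2 (by linear_combination -h)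
  have e3 : a + 1 ≠ a + 1 + 1 := fun h => h0 (by linear_combination -h)
  refine Equiv.ext fun j => ?_
  simp only [Equiv.Perm.mul_apply]
  by_cases ha : (j : ZMod (k + 1)) = a
  · have hj : ((j + 1 : ℤ) : ZMod (k + 1)) = a + 1 := by push_cast; rw [ha]
    have hj' : ((j + 1 + 1 : ℤ) : ZMod (k + 1)) = a + 1 + 1 := by push_cast; rw [ha]
    rw [sAff_apply_of_ne hk' (i := a + 1) (j := j) (by rwa [ha]) (by rwa [ha]),
      sAff_apply_of_eq hk' ha, sAff_apply_of_eq hk' hj,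
      sAff_apply_of_ne hk' (i := a) (j := j + 1 + 1) (by rw [hj']; exact e2.symm)
        (by rw [hj']; exact e3.symm)]
  by_cases hb : (j : ZMod (k + 1)) = a + 1
  · have hj : ((j + 1 : ℤ) : ZMod (k + 1)) = a + 1 + 1 := by push_cast; rw [hb]
    have hj' : ((j - 1 : ℤ) : ZMod (k + 1)) = a := by push_cast; rw [hb]; ring
    rw [sAff_apply_of_eq hk' hb, sAff_apply_of_ne hk' (i := a) (j := j + 1)
        (by rw [hj]; exact e2.symm) (by rw [hj]; exact e3.symm),
      sAff_apply_of_eq_add_one hk' hj, sAff_apply_of_eq_add_one hk' hb,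
      sAff_apply_of_ne hk' (i := a + 1) (by rwa [hj']) (by rwa [hj']), sAff_apply_of_eq hk' hj']
    ring
  by_cases hc : (j : ZMod (k + 1)) = a + 1 + 1
  · have hj : ((j - 1 : ℤ) : ZMod (k + 1)) = a + 1 := by push_cast; rw [hc]; ring
    have hj' : ((j - 1 - 1 : ℤ) : ZMod (k + 1)) = a := by push_cast; rw [hc]; ring
    rw [sAff_apply_of_eq_add_one hk' hc, sAff_apply_of_eq_add_one hk' hj,
      sAff_apply_of_ne hk' (i := a + 1) (by rwa [hj']) (by rwa [hj']),
      sAff_apply_of_ne hk' ha hb, sAff_apply_of_eq_add_one hk' hc,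
      sAff_apply_of_eq_add_one hk' hj]
  rw [sAff_apply_of_ne hk' hb hc, sAff_apply_of_ne hk' ha hb, sAff_apply_of_ne hk' hb hc,
    sAff_apply_of_ne hk' ha hb]

end SimpleGenerators

section CyclicallyDecreasing

variable {k : ℕ}

/-- The product of the `s_a`, `a ∈ A`, in decreasing cyclic order as seen from `g`. -/
noncomputable def dEltAt (k : ℕ) (g : ZMod (k + 1)) (A : Finset (ZMod (k + 1))) :
    Equiv.Perm ℤ :=
  (((((List.range (k + 1)).reverse.map fun t : ℕ => g + (t : ZMod (k + 1))).filter
      fun a => decide (a ∈ A)).map (sAff k)).prod)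

theorem gate_notMem {A : Finset (ZMod (k + 1))} (hA : A ≠ Finset.univ) : gate k A ∉ A := by
  have h : ∃ g, g ∉ A := by
    by_contra! h
    exact hA (Finset.eq_univ_iff_forall.2 h)
  rw [gate, dif_pos h]
  exact h.choose_spec

theorem exists_mem_sub_one_notMem {A : Finset (ZMod (k + 1))} (hA : A ≠ Finset.univ)
    (hne : A.Nonempty) : ∃ i ∈ A, i - 1 ∉ A := by
  by_contra! h
  obtain ⟨a, ha⟩ := hne
  have key : ∀ t : ℕ, a - (t : ZMod (k + 1)) ∈ A := by
    intro t
    induction t with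
    | zero => simpa using ha
    | succ t ih =>
      have := h _ ih
      rwa [sub_sub, ← Nat.cast_succ] at this
  refine hA (Finset.eq_univ_iff_forall.2 fun b => ?_)
  have := key (a - b).val
  rwa [ZMod.natCast_val, ZMod.cast_id, sub_sub_cancel] at this

theorem dEltAt_eq_erase_mul (hk : 1 ≤ k) {g i : ZMod (k + 1)} {A : Finset (ZMod (k + 1))}
    (hg : g ∉ A) (hi : i ∈ A) (hi' : i - 1 ∉ A) :
    dEltAt k g A = dEltAt k g (A.erase i) * sAff k i := by
  have key : ∀ n ≤ k + 1,
      (((((List.range n).reverse.map fun t : ℕ => g + (t : ZMod (k + 1))).filter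
        fun a => decide (a ∈ A)).map (sAff k)).prod) =
      (((((List.range n).reverse.map fun t : ℕ => g + (t : ZMod (k + 1))).filter
        fun a => decide (a ∈ A.erase i)).map (sAff k)).prod) *
        if (i - g).val < n then sAff k i else 1 := by
    intro n
    induction n with
    | zero => simp
    | succ n ih =>
      intro hn
      specialize ih (by omega)
      simp only [List.range_succ, List.reverse_append, List.reverse_singleton,
        List.singleton_append, List.map_cons, List.filter_cons]
      have hval : ∀ t ≤ k, g + (t : ZMod (k + 1)) = i ↔ t = (i - g).val := by
        intro t ht
        have hlt := ZMod.val_lt (i - g)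
        rw [← add_natCast_inj g ht (by omega), add_val_sub]
      rcases eq_or_ne (g + (n : ZMod (k + 1))) i with h | h
      · have hn' := (hval n (by omega)).1 h
        have hcomm : Commute (sAff k i)
            (((((List.range n).reverse.map fun t : ℕ => g + (t : ZMod (k + 1))).filter
              fun a => decide (a ∈ A.erase i)).map (sAff k)).prod) := by
          refine Commute.list_prod_right _ _ fun x hx => ?_
          simp only [List.mem_map, List.mem_filter, List.mem_reverse, List.mem_range,
            decide_eq_true_eq, Finset.mem_erase] at hx
          obtain ⟨_, ⟨⟨t, ht, rfl⟩, -, htA⟩, rfl⟩ := hx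
          refine sAff_commute hk (fun h' => hi' ?_) fun h' => ?_
          · rwa [h', add_sub_cancel_right]
          · rw [← h, add_assoc, ← Nat.cast_succ] at h'
            rcases eq_or_lt_of_le (show n ≤ k by omega) with rfl | hlt
            · rw [ZMod.natCast_self, add_zero] at h'
              exact hg (h' ▸ htA)
            · have := (add_natCast_inj g (by omega) (by omega)).1 h'
              omega
        rw [if_neg (by omega), mul_one] at ih
        simp only [h, hi, Finset.notMem_erase, decide_true, decide_false, if_true,
          Bool.false_eq_true, if_false, List.map_cons, List.prod_cons, ih]
        rw [if_pos (by omega)]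
        exact hcomm.eq
      · have hn' := (hval n (by omega)).not.1 h
        have hif : (if (i - g).val < n + 1 then sAff k i else 1) =
            if (i - g).val < n then sAff k i else 1 := by
          congr 1
          exact propext (by omega)
        rw [hif]
        by_cases hm : g + (n : ZMod (k + 1)) ∈ A
        · simp only [hm, Finset.mem_erase, ne_eq, h, not_false_eq_true, and_self, decide_true,
            if_true, List.map_cons, List.prod_cons, mul_assoc] at ih ⊢
          rw [ih]
        · simpa only [hm, Finset.mem_erase, and_false, decide_false, Bool.false_eq_true,
            if_false] using ih
  have h := key (k + 1) le_rfl
  rwa [if_pos (ZMod.val_lt _)] at h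

theorem dEltAt_empty (g : ZMod (k + 1)) : dEltAt k g ∅ = 1 := by
  simp [dEltAt]

theorem dEltAt_eq_dEltAt (hk : 1 ≤ k) {g g' : ZMod (k + 1)} (A : Finset (ZMod (k + 1)))
    (hg : g ∉ A) (hg' : g' ∉ A) : dEltAt k g A = dEltAt k g' A := by
  induction A using Finset.strongInduction with
  | H A ih =>
    rcases A.eq_empty_or_nonempty with rfl | hne
    · simp only [dEltAt_empty]
    · obtain ⟨i, hi, hi'⟩ := exists_mem_sub_one_notMem
        (A := A) (fun h => hg (h ▸ Finset.mem_univ g)) hne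
      rw [dEltAt_eq_erase_mul hk hg hi hi', dEltAt_eq_erase_mul hk hg' hi hi',
        ih _ (Finset.erase_ssubset hi) (fun h => hg (Finset.mem_of_mem_erase h))
          fun h => hg' (Finset.mem_of_mem_erase h)]

theorem dElt_empty : dElt k ∅ = 1 :=
  dEltAt_empty _

theorem erase_ne_univ {α : Type*} [Fintype α] [DecidableEq α] (A : Finset α) (i : α) :
    A.erase i ≠ Finset.univ :=
  fun h => Finset.notMem_erase i A (h ▸ Finset.mem_univ i)

theorem dElt_eq_erase_mul (hk : 1 ≤ k) {i : ZMod (k + 1)} {A : Finset (ZMod (k + 1))}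
    (hi : i ∈ A) (hi' : i - 1 ∉ A) : dElt k A = dElt k (A.erase i) * sAff k i := by
  have hA : A ≠ Finset.univ := fun h => hi' (h ▸ Finset.mem_univ _)
  have hg := gate_notMem hA
  exact (dEltAt_eq_erase_mul hk hg hi hi').trans <| congrArg (· * _) <|
    dEltAt_eq_dEltAt hk _ (fun h => hg (Finset.mem_of_mem_erase h))
      (gate_notMem (erase_ne_univ A i))

theorem dElt_eq_mul_erase (hk : 1 ≤ k) {i : ZMod (k + 1)} {A : Finset (ZMod (k + 1))}
    (hi : i ∈ A) (hi' : i + 1 ∉ A) : dElt k A = sAff k i * dElt k (A.erase i) := by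
  induction A using Finset.strongInduction with
  | H A ih =>
    rcases (A.erase i).eq_empty_or_nonempty with he | hne
    · have him : i - 1 ∉ A := fun h => by
        have : i - 1 ∈ A.erase i := Finset.mem_erase.2
          ⟨fun h' => zmod_one_ne_zero hk (by linear_combination -h'), h⟩
        simp [he] at this
      rw [dElt_eq_erase_mul hk hi him, he, dElt_empty, one_mul, mul_one]
    · obtain ⟨m, hm, hm'⟩ := exists_mem_sub_one_notMem (erase_ne_univ A i) hne
      obtain ⟨hmi, hmA⟩ := Finset.mem_erase.1 hm
      have hmA' : m - 1 ∉ A := fun h => hm' <| Finset.mem_erase.2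
        ⟨fun h' => hi' (by rwa [← h', sub_add_cancel]), h⟩
      rw [dElt_eq_erase_mul hk hmA hmA', dElt_eq_erase_mul hk hm hm',
        ih _ (Finset.erase_ssubset hmA) (Finset.mem_erase.2 ⟨hmi.symm, hi⟩)
          fun h => hi' (Finset.mem_of_mem_erase h), Finset.erase_right_comm, mul_assoc]

end CyclicallyDecreasing

section Runs

variable {k : ℕ}

/-- The decreasing product `s_{a+m-1} ⋯ s_{a+1} s_a`. -/
noncomputable def decRun (k : ℕ) (a : ZMod (k + 1)) : ℕ → Equiv.Perm ℤ
  | 0 => 1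
  | m + 1 => sAff k (a + (m : ZMod (k + 1))) * decRun k a m

/-- The set `{a, a+1, …, a+m-1}` of residues. -/
def runSet (k : ℕ) (a : ZMod (k + 1)) (m : ℕ) : Finset (ZMod (k + 1)) :=
  (Finset.range m).image fun t : ℕ => a + (t : ZMod (k + 1))

theorem mem_runSet {a b : ZMod (k + 1)} {m : ℕ} :
    b ∈ runSet k a m ↔ ∃ t < m, a + (t : ZMod (k + 1)) = b := by
  simp [runSet]

theorem add_natCast_mem_runSet {a : ZMod (k + 1)} {m t : ℕ} (ht : t ≤ k) (hm : m ≤ k + 1) :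
    a + (t : ZMod (k + 1)) ∈ runSet k a m ↔ t < m := by
  rw [mem_runSet]
  constructor
  · rintro ⟨s, hs, h⟩
    rwa [← (add_natCast_inj a (by omega) ht).1 h]
  · exact fun h => ⟨t, h, rfl⟩

theorem runSet_succ (a : ZMod (k + 1)) (m : ℕ) :
    runSet k a (m + 1) = insert (a + (m : ZMod (k + 1))) (runSet k a m) := by
  rw [runSet, Finset.range_add_one, Finset.image_insert, runSet]

theorem runSet_succ_bottom (a : ZMod (k + 1)) (m : ℕ) :
    runSet k a (m + 1) = insert a (runSet k (a + 1) m) := by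
  induction m with
  | zero => simp [runSet]
  | succ m ih =>
    rw [runSet_succ, ih, runSet_succ (a + 1), Finset.insert_comm]
    congr 2
    push_cast
    ring

theorem card_runSet {a : ZMod (k + 1)} {m : ℕ} (hm : m ≤ k + 1) : (runSet k a m).card = m := by
  rw [runSet, Finset.card_image_of_injOn, Finset.card_range]
  intro s hs t ht h
  simp only [Finset.coe_range, Set.mem_Iio] at hs ht
  exact (add_natCast_inj a (by omega) (by omega)).1 h

theorem cycInt_eq_runSet (i j : ZMod (k + 1)) : cycInt k i j = runSet k i ((j - i).val + 1) :=
  rfl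

theorem decRun_add (a : ZMod (k + 1)) (m r : ℕ) :
    decRun k a (m + r) = decRun k (a + (m : ZMod (k + 1))) r * decRun k a m := by
  induction r with
  | zero => simp [decRun]
  | succ r ih =>
    rw [← add_assoc, decRun, ih, decRun, mul_assoc, Nat.cast_add, add_assoc]

theorem decRun_succ_bottom (a : ZMod (k + 1)) (m : ℕ) :
    decRun k a (m + 1) = decRun k (a + 1) m * sAff k a := by
  rw [add_comm m 1, decRun_add]
  simp [decRun]

theorem dElt_runSet (hk : 1 ≤ k) (a : ZMod (k + 1)) {m : ℕ} (hm : m ≤ k) :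
    dElt k (runSet k a m) = decRun k a m := by
  induction m with
  | zero => exact dElt_empty
  | succ m ih =>
    have htop : a + (m : ZMod (k + 1)) + 1 ∉ runSet k a (m + 1) := by
      rw [add_assoc, ← Nat.cast_succ, add_natCast_mem_runSet hm (by omega)]
      omega
    have hnot : a + (m : ZMod (k + 1)) ∉ runSet k a m := by
      rw [add_natCast_mem_runSet (by omega) (by omega)]
      omega
    rw [dElt_eq_mul_erase hk (by simp [runSet_succ]) htop, runSet_succ,
      Finset.erase_insert hnot, ih (by omega), decRun]

theorem dElt_erase_runSet (hk : 1 ≤ k) (a : ZMod (k + 1)) {m r : ℕ} (h : m + 1 + r ≤ k) :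
    dElt k ((runSet k a (m + 1 + r)).erase (a + (m : ZMod (k + 1)))) =
      decRun k (a + ((m + 1 : ℕ) : ZMod (k + 1))) r * decRun k a m := by
  induction r with
  | zero =>
    have hnot : a + (m : ZMod (k + 1)) ∉ runSet k a m := by
      rw [add_natCast_mem_runSet (by omega) (by omega)]
      omega
    rw [add_zero, runSet_succ, Finset.erase_insert hnot, dElt_runSet hk a (by omega), decRun,
      one_mul]
  | succ r ih =>
    have hmem : a + ((m + 1 + r : ℕ) : ZMod (k + 1)) ∈
        (runSet k a (m + 1 + (r + 1))).erase (a + (m : ZMod (k + 1))) := by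
      rw [Finset.mem_erase, ne_eq, add_natCast_inj a (by omega) (by omega),
        add_natCast_mem_runSet (by omega) (by omega)]
      omega
    have htop : a + ((m + 1 + r : ℕ) : ZMod (k + 1)) + 1 ∉
        (runSet k a (m + 1 + (r + 1))).erase (a + (m : ZMod (k + 1))) := by
      rw [add_assoc a, ← Nat.cast_succ, Finset.mem_erase,
        add_natCast_mem_runSet (by omega) (by omega)]
      omega
    have hnot : a + ((m + 1 + r : ℕ) : ZMod (k + 1)) ∉ runSet k a (m + 1 + r) := by
      rw [add_natCast_mem_runSet (by omega) (by omega)]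
      omega
    rw [dElt_eq_mul_erase hk hmem htop, Finset.erase_right_comm, ← add_assoc (m + 1) r 1,
      runSet_succ, Finset.erase_insert hnot, ih (by omega), decRun, mul_assoc, add_assoc a,
      ← Nat.cast_add]

theorem sAff_commute_add (hk : 1 ≤ k) (a : ZMod (k + 1)) {s t : ℕ} (hst : s + 2 ≤ t)
    (ht : t < k + s) (htk : t ≤ k) :
    Commute (sAff k (a + (t : ZMod (k + 1)))) (sAff k (a + (s : ZMod (k + 1)))) := by
  refine sAff_commute hk (fun h => ?_) fun h => ?_
  · rw [add_assoc, ← Nat.cast_succ, add_natCast_inj a htk (by omega)] at h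
    omega
  · rw [add_assoc, ← Nat.cast_succ] at h
    rcases eq_or_lt_of_le htk with rfl | hlt
    · rw [ZMod.natCast_self, ← Nat.cast_zero, add_natCast_inj a (by omega) (by omega)] at h
      omega
    · rw [add_natCast_inj a (by omega) (by omega)] at h
      omega

theorem sAff_commute_decRun (hk : 1 ≤ k) (a : ZMod (k + 1)) {m t : ℕ} (hm : m + 1 ≤ t)
    (ht : t < k) : Commute (sAff k (a + (t : ZMod (k + 1)))) (decRun k a m) := by
  induction m with
  | zero => exact Commute.one_right _
  | succ m ih =>
    exact (sAff_commute_add hk a (by omega) (by omega) (by omega)).mul_right (ih (by omega))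

theorem decRun_mul_sAff (a : ZMod (k + 1)) {m t : ℕ} (ht : t + 1 < m) (hm : m ≤ k) :
    decRun k a m * sAff k (a + ((t + 1 : ℕ) : ZMod (k + 1))) =
      sAff k (a + (t : ZMod (k + 1))) * decRun k a m := by
  induction m with
  | zero => omega
  | succ m ih =>
    rcases eq_or_lt_of_le (show t + 1 ≤ m by omega) with rfl | hlt
    · have hc := sAff_commute_decRun (by omega) a (le_refl (t + 1)) (show t + 1 < k by omega)
      have hb := sAff_braid (show 2 ≤ k by omega) (a + (t : ZMod (k + 1)))
      rw [add_assoc, ← Nat.cast_succ] at hb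
      simp only [decRun]
      rw [mul_assoc, mul_assoc, ← hc.eq, ← mul_assoc, ← mul_assoc, hb]
      simp only [mul_assoc]
    · have hc := sAff_commute_add (by omega) a (show t + 2 ≤ m by omega)
        (by omega) (by omega)
      rw [decRun, mul_assoc, ih hlt (by omega), ← mul_assoc, hc.eq, mul_assoc]

theorem decRun_mul_decRun_succ (a : ZMod (k + 1)) {m r : ℕ} (hr : r < m) (hm : m ≤ k) :
    decRun k a m * decRun k (a + 1) r = decRun k a r * decRun k a m := by
  induction r with
  | zero => simp [decRun]
  | succ r ih =>
    have h : a + 1 + (r : ZMod (k + 1)) = a + ((r + 1 : ℕ) : ZMod (k + 1)) := by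
      push_cast
      ring
    rw [decRun, h, ← mul_assoc, decRun_mul_sAff a hr hm, mul_assoc, ih (by omega), decRun,
      mul_assoc]

theorem decRun_mul_self (hk : 1 ≤ k) (a : ZMod (k + 1)) {m : ℕ} (hm : m + 1 ≤ k) :
    decRun k a (m + 1) * decRun k a (m + 1) = decRun k a m * decRun k (a + 1) m := by
  conv_lhs => rw [decRun_succ_bottom a m, ← mul_assoc, ← decRun_succ_bottom,
    decRun_mul_decRun_succ a (Nat.lt_succ_self m) hm, decRun_succ_bottom, mul_assoc, mul_assoc,
    sAff_mul_self hk, mul_one]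

/-- `x` is a product of `n` simple generators. -/
def IsWordProd (k n : ℕ) (x : Equiv.Perm ℤ) : Prop :=
  ∃ w : List (ZMod (k + 1)), w.length = n ∧ x = (w.map (sAff k)).prod

theorem IsWordProd.affLen_le {n : ℕ} {x : Equiv.Perm ℤ} (h : IsWordProd k n x) :
    affLen k x ≤ n :=
  Nat.sInf_le h

theorem IsWordProd.mul {m n : ℕ} {x y : Equiv.Perm ℤ} (hx : IsWordProd k m x)
    (hy : IsWordProd k n y) : IsWordProd k (m + n) (x * y) := by
  obtain ⟨v, rfl, rfl⟩ := hx
  obtain ⟨w, rfl, rfl⟩ := hy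
  exact ⟨v ++ w, by simp, by simp⟩

theorem isWordProd_decRun (a : ZMod (k + 1)) (m : ℕ) : IsWordProd k m (decRun k a m) := by
  induction m with
  | zero => exact ⟨[], rfl, rfl⟩
  | succ m ih =>
    have h : IsWordProd k 1 (sAff k (a + (m : ZMod (k + 1)))) :=
      ⟨[_], rfl, (mul_one _).symm⟩
    have h' := h.mul ih
    rwa [add_comm] at h'

theorem le_of_runSet_ne_univ {a : ZMod (k + 1)} {m : ℕ} (h : runSet k a m ≠ Finset.univ) :
    m ≤ k := by
  by_contra! hm
  refine h (Finset.eq_univ_iff_forall.2 fun b => mem_runSet.2 ⟨(b - a).val, ?_, add_val_sub a b⟩)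
  have := ZMod.val_lt (b - a)
  omega

end Runs

section TwoRowMoves

variable {k : ℕ}

theorem dElt_mul_dElt_commutation (hk : 1 ≤ k) {A B : Finset (ZMod (k + 1))} {i : ZMod (k + 1)}
    (hB : i ∈ B) (hB' : i - 1 ∉ B) (hA : i ∉ A) (hA' : i + 1 ∉ A) :
    dElt k B * dElt k A = dElt k (B.erase i) * dElt k (insert i A) := by
  have h : i + 1 ∉ insert i A := by
    rw [Finset.mem_insert, not_or]
    exact ⟨fun h => zmod_one_ne_zero hk (by linear_combination h), hA'⟩
  rw [dElt_eq_erase_mul hk hB hB', dElt_eq_mul_erase hk (Finset.mem_insert_self i A) h,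
    Finset.erase_insert hA, mul_assoc]

theorem dElt_mul_dElt_chute (hk : 1 ≤ k) (a : ZMod (k + 1)) {m r : ℕ} (h : m + 1 + r ≤ k) :
    dElt k (runSet k a (m + 1 + r)) * dElt k (runSet k (a + 1) m) =
      dElt k ((runSet k a (m + 1 + r)).erase (a + (m : ZMod (k + 1)))) *
        dElt k (insert a (runSet k (a + 1) m)) := by
  rw [dElt_erase_runSet hk a h, ← runSet_succ_bottom, dElt_runSet hk a h,
    dElt_runSet hk _ (by omega), dElt_runSet hk a (by omega), decRun_add, mul_assoc, mul_assoc,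
    decRun_mul_decRun_succ a (Nat.lt_succ_self m) (by omega)]

theorem affLen_dElt_mul_dElt_le (hk : 1 ≤ k) (a : ZMod (k + 1)) {u m r : ℕ}
    (hu : u + (m + 1) ≤ k) (hr : m + 1 + r ≤ k) :
    affLen k (dElt k (runSet k (a + (u : ZMod (k + 1))) (m + 1 + r)) *
      dElt k (runSet k a (u + (m + 1)))) ≤ r + (m + m) + u := by
  rw [dElt_runSet hk _ hr, dElt_runSet hk _ hu, decRun_add, decRun_add a, mul_assoc,
    ← mul_assoc (decRun k (a + (u : ZMod (k + 1))) (m + 1)), decRun_mul_self hk _ (by omega),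
    ← mul_assoc]
  exact (((isWordProd_decRun _ r).mul ((isWordProd_decRun _ m).mul
    (isWordProd_decRun _ m))).mul (isWordProd_decRun a u)).affLen_le

end TwoRowMoves

/-- the two-row moves (commutation, chute, zero). -/
theorem two_row_moves (k : ℕ) (hk : 1 ≤ k) (A B : Finset (ZMod (k + 1)))
    (hA : A ≠ Finset.univ) (hB : B ≠ Finset.univ) :
    (∀ i : ZMod (k + 1), i ∈ B → i - 1 ∉ B → i - 1 ∉ A → i ∉ A → i + 1 ∉ A →
      dElt k B * dElt k A = dElt k (B.erase i) * dElt k (insert i A)) ∧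
    (∀ i j p : ZMod (k + 1), A = cycInt k i j → B = cycInt k (i - 1) p →
      p ∉ A → j ∈ B →
      dElt k B * dElt k A = dElt k (B.erase j) * dElt k (insert (i - 1) A)) ∧
    (∀ i j p q : ZMod (k + 1), A = cycInt k i j → B = cycInt k p q →
      p ∈ A → j ∈ B →
      affLen k (dElt k B * dElt k A) < A.card + B.card) := by
  refine ⟨fun i hi hi' _ hiA hiA' => dElt_mul_dElt_commutation hk hi hi' hiA hiA', ?_, ?_⟩
  · rintro i j p rfl rfl - hj
    obtain ⟨t, ht⟩ : ∃ t, t = (j - i).val := ⟨_, rfl⟩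
    have hjt : j = i - 1 + ((t + 1 : ℕ) : ZMod (k + 1)) := by
      rw [← add_val_sub i j, ← ht]
      push_cast
      ring
    rw [cycInt_eq_runSet] at hA hB hj
    rw [cycInt_eq_runSet, cycInt_eq_runSet, ← ht]
    rw [← ht] at hA
    have htk := le_of_runSet_ne_univ hA
    have hBk := le_of_runSet_ne_univ hB
    rw [hjt] at hj
    have hlt := (add_natCast_mem_runSet htk (by omega)).1 hj
    obtain ⟨r, hr⟩ := Nat.exists_eq_add_of_le hlt
    rw [hr] at hBk ⊢
    have h := dElt_mul_dElt_chute hk (i - 1) hBk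
    rwa [sub_add_cancel, ← hjt] at h
  · rintro i j p q rfl rfl hp hj
    rw [cycInt_eq_runSet] at hA hB hp hj
    have hAk := le_of_runSet_ne_univ hA
    have hBk := le_of_runSet_ne_univ hB
    obtain ⟨u, hu, rfl⟩ := mem_runSet.1 hp
    obtain ⟨m, hm⟩ := Nat.exists_eq_add_of_le (Nat.le_of_lt_succ hu)
    have hjm : j = i + (u : ZMod (k + 1)) + (m : ZMod (k + 1)) := by
      rw [add_assoc, ← Nat.cast_add, ← hm, add_val_sub]
    have hlt : m < (q - (i + (u : ZMod (k + 1)))).val + 1 := by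
      rwa [hjm, add_natCast_mem_runSet (by omega) (by omega)] at hj
    obtain ⟨r, hr⟩ := Nat.exists_eq_add_of_le (Nat.succ_le_of_lt hlt)
    rw [Nat.succ_eq_add_one] at hr
    rw [cycInt_eq_runSet, cycInt_eq_runSet, card_runSet (by omega), card_runSet (by omega), hm,
      hr, add_assoc u m 1]
    have h := affLen_dElt_mul_dElt_le hk i (u := u) (m := m) (r := r) (by omega) (by omega)
    omega
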